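/- arXiv:hep-th/0609018 — 2 statements merged into one kernel-verified Lean document; each statement's English description precedes it below -/
import Mathlib

section
/- Let k ≥ 1 and let n₁, …, n_k be strictly positive real numbers. Then the sum over all permutations σ of {1, …, k} of the products ∏_{j=1}^{k} (n_{σ(1)} + n_{σ(2)} + ⋯ + n_{σ(j)})⁻¹ equals the product ∏_{j=1}^{k} n_j⁻¹. -/
open Finset

/-- The version of the identity with tail sums `n_{σ(j)} + ⋯ + n_{σ(k)}`. -/
theorem sum_perm_prod_inv_tail_sums {K : Type*} [Field K] [LinearOrder K] [IsStrictOrderedRing K]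
    (k : ℕ) (n : Fin k → K) (hn : ∀ i, 0 < n i) :
    ∑ σ : Equiv.Perm (Fin k), ∏ j : Fin k, (∑ i with j ≤ i, n (σ i))⁻¹ = ∏ j : Fin k, (n j)⁻¹ := by
  induction k with
  | zero => simp
  | succ k ih =>
    have hsum : ∑ i, n i ≠ 0 := (sum_pos (fun i _ => hn i) univ_nonempty).ne'
    have htail (p : Fin (k + 1)) :
        ∏ i : Fin k, (n (Equiv.swap 0 p i.succ))⁻¹ = n p * ∏ i, (n i)⁻¹ := by
      rw [← Equiv.prod_comp (Equiv.swap 0 p) (fun i => (n i)⁻¹), Fin.prod_univ_succ,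
        Equiv.swap_apply_left, mul_inv_cancel_left₀ (hn p).ne']
    have hterm (p : Fin (k + 1)) (e : Equiv.Perm (Fin k)) :
        ∏ j, (∑ i with j ≤ i, n (Equiv.Perm.decomposeFin.symm (p, e) i))⁻¹ =
          (∑ i, n i)⁻¹ * ∏ j, (∑ i with j ≤ i, n (Equiv.swap 0 p (e i).succ))⁻¹ := by
      rw [Fin.prod_univ_succ]
      congr 1
      · simp only [Fin.zero_le, filter_true]
        rw [Equiv.sum_comp]
      · simp [sum_filter, Fin.sum_univ_succ]
    rw [← Equiv.sum_comp Equiv.Perm.decomposeFin.symm, Fintype.sum_prod_type]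
    simp_rw [hterm, ← mul_sum]
    simp_rw [fun p => ih (fun i => n (Equiv.swap 0 p i.succ)) (fun _ => hn _), htail, ← sum_mul]
    rw [inv_mul_cancel_left₀ hsum]

/-- The combinatorial identity
`∑_σ ∏_{j=1}^k (n_{σ(1)} + ⋯ + n_{σ(j)})⁻¹ = ∏_{j=1}^k n_j⁻¹`
for strictly positive reals `n₁, …, n_k`. -/
theorem sum_perm_prod_inv_partial_sums
    (k : ℕ) (hk : 1 ≤ k) (n : Fin k → ℝ) (hn : ∀ i, 0 < n i) :
    ∑ σ : Equiv.Perm (Fin k),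
      ∏ j : Fin k, (∑ i ∈ Finset.univ.filter (fun i => i ≤ j), n (σ i))⁻¹
    = ∏ j : Fin k, (n j)⁻¹ := by
  rw [← sum_perm_prod_inv_tail_sums k n hn, ← Equiv.sum_comp (Equiv.mulRight Fin.revPerm)]
  refine sum_congr rfl fun σ _ => ?_
  rw [← Equiv.prod_comp Fin.revPerm]
  refine prod_congr rfl fun j _ => ?_
  rw [sum_filter, sum_filter, ← Equiv.sum_comp Fin.revPerm]
  simp
end

section
/- Let x, y, z be pairwise distinct complex numbers, let F(x, y) = (4x − y − 3z)/(15(y−z)(x−z)²(x−y)²), and let G(x, y) = −2(2x² + 2y² − xy − 3yz − 3zx + 3z²)/(15(y−z)(x−z)²(x−y)³). Then F(x, y) + F(y, x) + G(x, y) + G(y, x) = (x + y − 2z)²/(5(y−z)²(x−z)²(x−y)²). In particular, if moreover x + y ≠ 2z, this sum is nonzero. -/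
/-- The symmetrized total correlation factor of Example 2: with
`F(x,y) = (4x−y−3z)/(15(y−z)(x−z)²(x−y)²)` and
`G(x,y) = −2(2x²+2y²−xy−3yz−3zx+3z²)/(15(y−z)(x−z)²(x−y)³)`, one has
`F(x,y)+F(y,x)+G(x,y)+G(y,x) = (x+y−2z)²/(5(y−z)²(x−z)²(x−y)²)`,
which is nonzero whenever `x + y ≠ 2z`. -/
theorem example2_total_correlation (x y z : ℂ)
    (hxy : x ≠ y) (hxz : x ≠ z) (hyz : y ≠ z)
    (F G : ℂ → ℂ → ℂ)
    (hF : ∀ a b, F a b = (4 * a - b - 3 * z) / (15 * (b - z) * (a - z) ^ 2 * (a - b) ^ 2))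
    (hG : ∀ a b, G a b
      = -(2 * (2 * a ^ 2 + 2 * b ^ 2 - a * b - 3 * b * z - 3 * z * a + 3 * z ^ 2))
          / (15 * (b - z) * (a - z) ^ 2 * (a - b) ^ 3)) :
    F x y + F y x + G x y + G y x
        = (x + y - 2 * z) ^ 2 / (5 * (y - z) ^ 2 * (x - z) ^ 2 * (x - y) ^ 2) ∧
      (x + y ≠ 2 * z → F x y + F y x + G x y + G y x ≠ 0) := by
  have hxy' : x - y ≠ 0 := sub_ne_zero.mpr hxy
  have hxz' : x - z ≠ 0 := sub_ne_zero.mpr hxz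
  have hyz' : y - z ≠ 0 := sub_ne_zero.mpr hyz
  have key : F x y + F y x + G x y + G y x
      = (x + y - 2 * z) ^ 2 / (5 * (y - z) ^ 2 * (x - z) ^ 2 * (x - y) ^ 2) := by
    have hyx : (y - x) ^ 2 = (x - y) ^ 2 := by ring
    have hyx' : (y - x) ^ 3 = -(x - y) ^ 3 := by ring
    rw [hF, hF, hG, hG, hyx, hyx']
    field_simp
    ring
  refine ⟨key, fun h => ?_⟩
  rw [key]
  have hsum : x + y - 2 * z ≠ 0 := sub_ne_zero.mpr h
  simp [hsum, hxy', hxz', hyz']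
end
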